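/- arXiv:math-ph/0505053 — 2 statements merged into one kernel-verified Lean document; each statement's English description precedes it below -/
import Mathlib

section
/- For every level k > 2, the total odd interval length satisfies the lower bound 2/(k+1) + (2/3) * sum_{j=1}^{k-2} I_{k-j}^(e) * (2j+3)/((j+1)(j+2)) <= I_k^(o), and moreover I_k^(o) < 1. -/
/-- Numerators of the modified Farey sequence: at level `k`, order `n` (1-indexed,
`n = 1, …, 2^k + 1`). Level 0 is `0/1, 1/1`; odd orders at level `k+1` are carried
over from level `k`, even orders are mediants. -/
def fareyNum : ℕ → ℕ → ℕ
  | 0, n => if n = 1 then 0 else 1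
  | k + 1, m =>
      if m % 2 = 1 then fareyNum k ((m + 1) / 2)
      else fareyNum k (m / 2) + fareyNum k (m / 2 + 1)

/-- Denominators of the modified Farey sequence. -/
def fareyDen : ℕ → ℕ → ℕ
  | 0, _ => 1
  | k + 1, m =>
      if m % 2 = 1 then fareyDen k ((m + 1) / 2)
      else fareyDen k (m / 2) + fareyDen k (m / 2 + 1)

/-- The Farey fraction `r_k^(n) = n_k^(n) / d_k^(n)` as a real number. -/
noncomputable def fareyR (k n : ℕ) : ℝ := (fareyNum k n : ℝ) / (fareyDen k n : ℝ)

/-- The interval `I_k^(n)`: for `n ≥ 2` it is `r_k^(2n) - r_k^(2n-2)`, and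
`I_k^(1) := 2/(k+1)`. -/
noncomputable def fareyI (k n : ℕ) : ℝ :=
  if n = 1 then 2 / ((k : ℝ) + 1) else fareyR k (2 * n) - fareyR k (2 * n - 2)

/-- Total length of even intervals at level `k`. -/
noncomputable def fareyIe (k : ℕ) : ℝ :=
  ∑ i ∈ Finset.Icc 1 (2 ^ (k - 2)), fareyI k (2 * i)

/-- Total length of odd intervals at level `k`. -/
noncomputable def fareyIo (k : ℕ) : ℝ :=
  ∑ i ∈ Finset.Icc 1 (2 ^ (k - 2)), fareyI k (2 * i - 1)

/-- `S_k`: the sum of inverse squares of the new denominators at level `k`. -/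
noncomputable def fareyS (k : ℕ) : ℝ :=
  ∑ n ∈ Finset.Icc 1 (2 ^ (k - 1)), 1 / (fareyDen k (2 * n) : ℝ) ^ 2

theorem fareyDen_pos (k n : ℕ) : 0 < fareyDen k n := by
  induction k generalizing n with
  | zero => simp [fareyDen]
  | succ k ih =>
    rw [fareyDen]
    split_ifs
    · exact ih _
    · exact Nat.add_pos_left (ih _) _

theorem fareyDen_succ_odd (k n : ℕ) : fareyDen (k + 1) (2 * n + 1) = fareyDen k (n + 1) := by
  rw [fareyDen, if_pos (by omega), show (2 * n + 1 + 1) / 2 = n + 1 by omega]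

theorem fareyDen_succ_even (k n : ℕ) :
    fareyDen (k + 1) (2 * n) = fareyDen k n + fareyDen k (n + 1) := by
  rw [fareyDen, if_neg (by omega), show 2 * n / 2 = n by omega]

theorem fareyNum_succ_odd (k n : ℕ) : fareyNum (k + 1) (2 * n + 1) = fareyNum k (n + 1) := by
  rw [fareyNum, if_pos (by omega), show (2 * n + 1 + 1) / 2 = n + 1 by omega]

theorem fareyNum_succ_even (k n : ℕ) :
    fareyNum (k + 1) (2 * n) = fareyNum k n + fareyNum k (n + 1) := by
  rw [fareyNum, if_neg (by omega), show 2 * n / 2 = n by omega]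

/-- Consecutive Farey fractions are unimodular. -/
theorem fareyNum_mul_fareyDen (k n : ℕ) (h1 : 1 ≤ n) (hn : n ≤ 2 ^ k) :
    fareyNum k (n + 1) * fareyDen k n = fareyNum k n * fareyDen k (n + 1) + 1 := by
  induction k generalizing n with
  | zero =>
    obtain rfl : n = 1 := by simp at hn; omega
    simp [fareyNum, fareyDen]
  | succ k ih =>
    rw [pow_succ] at hn
    obtain ⟨p, rfl | rfl⟩ := Nat.even_or_odd' n
    · have := ih p (by omega) (by omega)
      rw [fareyNum_succ_odd, fareyDen_succ_odd, fareyNum_succ_even, fareyDen_succ_even]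
      linarith
    · have := ih (p + 1) (by omega) (by omega)
      rw [show 2 * p + 1 + 1 = 2 * (p + 1) by ring, fareyNum_succ_odd, fareyDen_succ_odd,
        fareyNum_succ_even, fareyDen_succ_even]
      linarith

theorem fareyR_succ_sub (k n : ℕ) (h1 : 1 ≤ n) (hn : n ≤ 2 ^ k) :
    fareyR k (n + 1) - fareyR k n = 1 / (fareyDen k n * fareyDen k (n + 1)) := by
  have h : (fareyNum k (n + 1) : ℝ) * fareyDen k n = fareyNum k n * fareyDen k (n + 1) + 1 :=
    mod_cast fareyNum_mul_fareyDen k n h1 hn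
  have h2 : (fareyDen k n : ℝ) ≠ 0 := mod_cast (fareyDen_pos k n).ne'
  have h3 : (fareyDen k (n + 1) : ℝ) ≠ 0 := mod_cast (fareyDen_pos k (n + 1)).ne'
  unfold fareyR
  field_simp
  linarith

/-- The distance between the two neighbours, at level `k + t`, of the fraction of order `n + 1`
at level `k`. -/
noncomputable def fareyGap (k n t : ℕ) : ℝ :=
  1 / (fareyDen k (n + 1) * (fareyDen k n + t * fareyDen k (n + 1))) +
    1 / (fareyDen k (n + 1) * (fareyDen k (n + 2) + t * fareyDen k (n + 1)))

theorem fareyGap_pos (k n t : ℕ) : 0 < fareyGap k n t := by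
  have h1 : (0 : ℝ) < fareyDen k n := mod_cast fareyDen_pos k n
  have h2 : (0 : ℝ) < fareyDen k (n + 1) := mod_cast fareyDen_pos k (n + 1)
  have h3 : (0 : ℝ) < fareyDen k (n + 2) := mod_cast fareyDen_pos k (n + 2)
  unfold fareyGap
  positivity

theorem fareyGap_succ (k n t : ℕ) : fareyGap (k + 1) (2 * n) t = fareyGap k n (t + 1) := by
  unfold fareyGap
  rw [show 2 * n + 2 = 2 * (n + 1) by ring, fareyDen_succ_odd, fareyDen_succ_even,
    fareyDen_succ_even]
  push_cast
  ring_nf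

theorem fareyR_even_sub (k n : ℕ) (h1 : 1 ≤ n) (hn : n + 1 ≤ 2 ^ k) :
    fareyR (k + 1) (2 * n + 2) - fareyR (k + 1) (2 * n) = fareyGap k n 1 := by
  have ha := fareyR_succ_sub (k + 1) (2 * n) (by omega) (by rw [pow_succ]; omega)
  have hb := fareyR_succ_sub (k + 1) (2 * n + 1) (by omega) (by rw [pow_succ]; omega)
  rw [show 2 * n + 1 + 1 = 2 * n + 2 by ring] at hb
  have : fareyGap k n 1 = fareyGap (k + 1) (2 * n) 0 := (fareyGap_succ k n 0).symm
  rw [this, ← sub_add_sub_cancel (fareyR (k + 1) (2 * n + 2)) (fareyR (k + 1) (2 * n + 1)), ha, hb]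
  unfold fareyGap
  push_cast
  ring

/-- For a mediant, the neighbour distance decays no faster than `(2j+3)/((j+1)(j+2))`. -/
theorem fareyGap_mediant_lower_bound (p i j : ℕ) :
    (2 / 3) * (fareyGap (p + 1) (2 * i + 1) 1 * (2 * (j : ℝ) + 3) / (((j : ℝ) + 1) * (j + 2))) ≤
      fareyGap (p + 1) (2 * i + 1) (j + 1) := by
  have ha : (0 : ℝ) < fareyDen p (i + 1) := mod_cast fareyDen_pos _ _
  have hb : (0 : ℝ) < fareyDen p (i + 2) := mod_cast fareyDen_pos _ _
  unfold fareyGap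
  rw [show 2 * i + 1 + 2 = 2 * (i + 1) + 1 by ring, show 2 * i + 1 + 1 = 2 * (i + 1) by ring,
    fareyDen_succ_even, fareyDen_succ_odd, fareyDen_succ_odd]
  push_cast
  rw [show i + 1 + 1 = i + 2 by ring]
  generalize (fareyDen p (i + 1) : ℝ) = a at *
  generalize (fareyDen p (i + 2) : ℝ) = b at *
  have hj : (0 : ℝ) ≤ j := j.cast_nonneg
  generalize (j : ℝ) = x at *
  have key (s : ℝ) (hs : 0 < s) : 1 / ((a + b) * (a + s * (a + b))) +
      1 / ((a + b) * (b + s * (a + b))) =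
      (2 * s + 1) / ((a + s * (a + b)) * (b + s * (a + b))) := by
    field_simp
    ring
  rw [key 1 one_pos, key (x + 1) (by positivity)]
  rw [show (2 / 3) * ((2 * (1 : ℝ) + 1) / ((a + 1 * (a + b)) * (b + 1 * (a + b))) * (2 * x + 3) /
      ((x + 1) * (x + 2))) = (2 * (x + 1) + 1) * 2 /
      ((a + 1 * (a + b)) * (b + 1 * (a + b)) * ((x + 1) * (x + 2))) by field_simp; ring]
  rw [div_le_div_iff₀ (by positivity) (by positivity), mul_assoc]
  refine mul_le_mul_of_nonneg_left ?_ (by positivity)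
  have : 0 ≤ a * b * (x * (x + 3)) := by positivity
  nlinarith

theorem sum_range_two_mul_add_one (g : ℕ → ℝ) (N : ℕ) :
    ∑ i ∈ Finset.range (2 * N + 1), g i =
      ∑ i ∈ Finset.range N, g (2 * i + 1) + ∑ i ∈ Finset.range (N + 1), g (2 * i) := by
  induction N with
  | zero => simp
  | succ N ih =>
    rw [show 2 * (N + 1) + 1 = 2 * N + 1 + 1 + 1 by ring, Finset.sum_range_succ,
      Finset.sum_range_succ, ih, Finset.sum_range_succ (fun i => g (2 * i + 1)) N,
      Finset.sum_range_succ (fun i => g (2 * i)) (N + 1),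
      show 2 * (N + 1) = 2 * N + 1 + 1 by ring]
    ring

theorem sum_Icc_one_eq_sum_range (g : ℕ → ℝ) (N : ℕ) :
    ∑ i ∈ Finset.Icc 1 N, g i = ∑ i ∈ Finset.range N, g (i + 1) := by
  induction N with
  | zero => simp
  | succ N ih => rw [Finset.sum_Icc_succ_top (by omega), Finset.sum_range_succ, ih]

/-- Classify the interior fractions at level `m` by the level at which they first appear. -/
theorem sum_fareyGap_eq (m t : ℕ) :
    ∑ i ∈ Finset.range (2 ^ m - 1), fareyGap m (i + 1) t =
      ∑ j ∈ Finset.range m, ∑ i ∈ Finset.range (2 ^ (m - 1 - j)),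
        fareyGap (m - 1 - j + 1) (2 * i + 1) (t + j) := by
  induction m generalizing t with
  | zero => simp
  | succ m ih =>
    have hpos : 0 < 2 ^ m := by positivity
    rw [show 2 ^ (m + 1) - 1 = 2 * (2 ^ m - 1) + 1 by rw [pow_succ]; omega,
      sum_range_two_mul_add_one, Nat.sub_add_cancel hpos, Finset.sum_range_succ' _ m]
    congr 1
    have gap (i : ℕ) : fareyGap (m + 1) (2 * i + 1 + 1) t = fareyGap m (i + 1) (t + 1) :=
      fareyGap_succ m (i + 1) t
    simp only [gap, ih]
    refine Finset.sum_congr rfl fun j _ => ?_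
    rw [show m + 1 - 1 - (j + 1) = m - 1 - j by omega, show t + (j + 1) = t + 1 + j by ring]

theorem fareyI_eq_fareyGap (k n : ℕ) (h1 : 1 ≤ n) (hn : n + 1 ≤ 2 ^ k) :
    fareyI (k + 1) (n + 1) = fareyGap k n 1 := by
  rw [fareyI, if_neg (by omega), ← fareyR_even_sub k n h1 hn]
  rfl

theorem fareyIe_eq (p : ℕ) :
    fareyIe (p + 2) = ∑ i ∈ Finset.range (2 ^ p), fareyGap (p + 1) (2 * i + 1) 1 := by
  rw [fareyIe, Nat.add_sub_cancel, sum_Icc_one_eq_sum_range]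
  refine Finset.sum_congr rfl fun i hi => ?_
  rw [Finset.mem_range] at hi
  exact fareyI_eq_fareyGap (p + 1) (2 * i + 1) (by omega) (by rw [pow_succ]; omega)

theorem fareyIe_pos (p : ℕ) : 0 < fareyIe (p + 2) := by
  rw [fareyIe_eq]
  exact Finset.sum_pos (fun i _ => fareyGap_pos _ _ _) (by simp)

theorem fareyIo_eq (m : ℕ) :
    fareyIo (m + 2) = 2 / ((m : ℝ) + 2 + 1) +
      ∑ i ∈ Finset.range (2 ^ m - 1), fareyGap m (i + 1) 2 := by
  have hpos : 0 < 2 ^ m := by positivity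
  rw [fareyIo, Nat.add_sub_cancel, sum_Icc_one_eq_sum_range, ← Nat.sub_add_cancel hpos,
    Finset.sum_range_succ', add_comm, Nat.sub_add_cancel hpos]
  congr 1
  · simp [fareyI]
  · refine Finset.sum_congr rfl fun i hi => ?_
    rw [Finset.mem_range] at hi
    rw [← fareyGap_succ]
    exact fareyI_eq_fareyGap (m + 1) (2 * (i + 1)) (by omega) (by rw [pow_succ]; omega)

theorem fareyNum_one (k : ℕ) : fareyNum k 1 = 0 := by
  induction k with
  | zero => rfl
  | succ k ih => simpa [ih] using fareyNum_succ_odd k 0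

theorem fareyDen_one (k : ℕ) : fareyDen k 1 = 1 := by
  induction k with
  | zero => rfl
  | succ k ih => simpa [ih] using fareyDen_succ_odd k 0

theorem fareyNum_last (k : ℕ) : fareyNum k (2 ^ k + 1) = 1 := by
  induction k with
  | zero => rfl
  | succ k ih => rw [pow_succ', fareyNum_succ_odd, ih]

theorem fareyDen_last (k : ℕ) : fareyDen k (2 ^ k + 1) = 1 := by
  induction k with
  | zero => rfl
  | succ k ih => rw [pow_succ', fareyDen_succ_odd, ih]

theorem fareyNum_two (k : ℕ) : fareyNum k 2 = 1 := by
  induction k with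
  | zero => rfl
  | succ k ih => simpa [ih, fareyNum_one] using fareyNum_succ_even k 1

theorem fareyDen_two (k : ℕ) : fareyDen k 2 = k + 1 := by
  induction k with
  | zero => rfl
  | succ k ih => simpa [ih, fareyDen_one, add_comm, add_left_comm] using fareyDen_succ_even k 1

theorem fareyNum_two_pow (k : ℕ) : fareyNum k (2 ^ k) = k := by
  induction k with
  | zero => rfl
  | succ k ih => rw [pow_succ', fareyNum_succ_even, ih, fareyNum_last]

theorem fareyDen_two_pow (k : ℕ) : fareyDen k (2 ^ k) = k + 1 := by
  induction k with
  | zero => rfl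
  | succ k ih => rw [pow_succ', fareyDen_succ_even, ih, fareyDen_last]

/-- The intervals at each level have total length one. -/
theorem fareyIo_add_fareyIe (m : ℕ) : fareyIo (m + 2) + fareyIe (m + 2) = 1 := by
  have hpos : 0 < 2 ^ m := by positivity
  have split := sum_range_two_mul_add_one (fun i => fareyGap (m + 1) (i + 1) 1) (2 ^ m - 1)
  rw [Nat.sub_add_cancel hpos] at split
  have tele := Finset.sum_range_sub (fun i => fareyR (m + 2) (2 * (i + 1)))
    (2 * (2 ^ m - 1) + 1)
  have gap (i : ℕ) (hi : i ∈ Finset.range (2 * (2 ^ m - 1) + 1)) :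
      fareyR (m + 2) (2 * (i + 1 + 1)) - fareyR (m + 2) (2 * (i + 1)) =
        fareyGap (m + 1) (i + 1) 1 := by
    rw [Finset.mem_range] at hi
    exact fareyR_even_sub (m + 1) (i + 1) (by omega) (by rw [pow_succ]; omega)
  rw [Finset.sum_congr rfl gap, split,
    show 2 * (2 * (2 ^ m - 1) + 1 + 1) = 2 ^ (m + 2) by rw [pow_add]; omega] at tele
  rw [fareyIo_eq, fareyIe_eq,
    Finset.sum_congr rfl fun i _ => (fareyGap_succ m (i + 1) 1).symm, add_assoc]
  refine (congrArg _ tele).trans ?_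
  simp only [fareyR, fareyNum_two_pow, fareyDen_two_pow, zero_add, mul_one, fareyNum_two,
    fareyDen_two]
  push_cast
  field_simp
  ring

/-- Lower bound for the total odd interval length, and `I_k^(o) < 1`, for `k > 2`. -/
theorem fareyIo_lower_bound (k : ℕ) (hk : 2 < k) :
    2 / ((k : ℝ) + 1) +
        (2 / 3) * ∑ j ∈ Finset.Icc 1 (k - 2),
          fareyIe (k - j) * (2 * (j : ℝ) + 3) / (((j : ℝ) + 1) * ((j : ℝ) + 2)) ≤
      fareyIo k ∧ fareyIo k < 1 := by
  obtain ⟨m, rfl⟩ : ∃ m, k = m + 2 := ⟨k - 2, by omega⟩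
  refine ⟨?_, by linarith [fareyIo_add_fareyIe m, fareyIe_pos m]⟩
  rw [fareyIo_eq, sum_fareyGap_eq, Nat.add_sub_cancel, sum_Icc_one_eq_sum_range, Finset.mul_sum]
  push_cast
  refine add_le_add le_rfl (Finset.sum_le_sum fun j hj => ?_)
  rw [Finset.mem_range] at hj
  rw [show m + 1 - j = m - 1 - j + 2 by omega, fareyIe_eq, Finset.sum_mul, Finset.sum_div,
    Finset.mul_sum]
  refine Finset.sum_le_sum fun i _ => ?_
  have h := fareyGap_mediant_lower_bound (m - 1 - j) i (j + 1)
  rw [show j + 1 + 1 = 2 + j by ring] at h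
  exact_mod_cast h
end

section
/- For every level k >= 2, the total even interval length satisfies 0 < I_k^(e) < 1. -/
theorem fareyNum_le_fareyDen (k n : ℕ) : fareyNum k n ≤ fareyDen k n := by
  induction k generalizing n with
  | zero => rw [fareyNum, fareyDen]; split_ifs <;> omega
  | succ k ih =>
    rw [fareyNum, fareyDen]
    split_ifs
    · exact ih _
    · exact Nat.add_le_add (ih _) (ih _)

/-- Consecutive Farey fractions are unimodular. -/
theorem fareyNum_succ_mul_fareyDen (k n : ℕ) (h1 : 1 ≤ n) (h2 : n ≤ 2 ^ k) :
    fareyNum k (n + 1) * fareyDen k n = fareyNum k n * fareyDen k (n + 1) + 1 := by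
  induction k generalizing n with
  | zero =>
    obtain rfl : n = 1 := by simp at h2; omega
    simp [fareyNum, fareyDen]
  | succ k ih =>
    rw [pow_succ] at h2
    simp only [fareyNum, fareyDen]
    rcases Nat.even_or_odd' n with ⟨m, rfl | rfl⟩
    · have h := ih m (by omega) (by omega)
      rw [if_pos (by omega), if_neg (by omega), if_neg (by omega), if_pos (by omega),
        show (2 * m + 1 + 1) / 2 = m + 1 by omega, show 2 * m / 2 = m by omega]
      linarith
    · have h := ih (m + 1) (by omega) (by omega)
      rw [if_neg (by omega), if_pos (by omega), if_pos (by omega), if_neg (by omega),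
        show (2 * m + 1 + 1) / 2 = m + 1 by omega]
      linarith

theorem fareyR_lt_succ (k n : ℕ) (h1 : 1 ≤ n) (h2 : n ≤ 2 ^ k) :
    fareyR k n < fareyR k (n + 1) := by
  have hn : (0 : ℝ) < fareyDen k n := mod_cast fareyDen_pos k n
  have hn' : (0 : ℝ) < fareyDen k (n + 1) := mod_cast fareyDen_pos k (n + 1)
  rw [fareyR, fareyR, div_lt_div_iff₀ hn hn']
  exact_mod_cast Nat.lt_of_succ_le (fareyNum_succ_mul_fareyDen k n h1 h2).ge

theorem fareyR_nonneg (k n : ℕ) : 0 ≤ fareyR k n := by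
  unfold fareyR; positivity

theorem fareyR_le_one (k n : ℕ) : fareyR k n ≤ 1 :=
  div_le_one_of_le₀ (mod_cast fareyNum_le_fareyDen k n) (Nat.cast_nonneg _)

theorem fareyI_two_mul_succ (k m : ℕ) :
    fareyI k (2 * (m + 1)) = fareyR k (4 * m + 4) - fareyR k (4 * m + 2) := by
  rw [fareyI, if_neg (by omega), show 2 * (2 * (m + 1)) = 4 * m + 4 by ring]
  rfl

theorem sum_fareyI_two_mul_lt (k m : ℕ) (hm : 4 * (m + 1) ≤ 2 ^ k) :
    ∑ i ∈ Finset.Icc 1 (m + 1), fareyI k (2 * i) < fareyR k (4 * (m + 1) + 1) := by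
  have hlast : fareyR k (4 * m + 4) < fareyR k (4 * (m + 1) + 1) :=
    fareyR_lt_succ k _ (by omega) (by omega)
  have hfirst : fareyR k (4 * m + 1) < fareyR k (4 * m + 2) :=
    fareyR_lt_succ k _ (by omega) (by omega)
  rw [Finset.sum_Icc_succ_top (by omega), fareyI_two_mul_succ]
  cases m with
  | zero =>
    have := fareyR_nonneg k (4 * 0 + 1)
    simp only [zero_add, Finset.Icc_eq_empty_of_lt zero_lt_one, Finset.sum_empty] at *
    linarith
  | succ m =>
    have := sum_fareyI_two_mul_lt k m (by omega)
    linarith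

/-- For `k ≥ 2`, `0 < I_k^(e) < 1`. -/
theorem fareyIe_pos_lt_one (k : ℕ) (hk : 2 ≤ k) :
    0 < fareyIe k ∧ fareyIe k < 1 := by
  have hpow : 4 * 2 ^ (k - 2) = 2 ^ k := by
    rw [← Nat.sub_add_cancel hk, pow_add, Nat.add_sub_cancel]; ring
  have hone : 1 ≤ 2 ^ (k - 2) := Nat.one_le_two_pow
  unfold fareyIe
  constructor
  · refine Finset.sum_pos (fun i hi => ?_) (Finset.nonempty_Icc.2 hone)
    obtain ⟨hi1, hi2⟩ := Finset.mem_Icc.1 hi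
    obtain ⟨m, rfl⟩ := Nat.exists_eq_add_of_le' hi1
    rw [fareyI_two_mul_succ]
    exact sub_pos.2 ((fareyR_lt_succ k (4 * m + 2) (by omega) (by omega)).trans
      (fareyR_lt_succ k (4 * m + 3) (by omega) (by omega)))
  · obtain ⟨m, hm⟩ := Nat.exists_eq_add_of_le' hone
    rw [hm] at hpow ⊢
    exact (sum_fareyI_two_mul_lt k m hpow.le).trans_le (fareyR_le_one k _)
end
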